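/- Let α > 0. For every index j with 1 ≤ j ≤ n, the Riemann–Liouville fractional integral of order α of the first modified hat function satisfies (I^α ψ_0^M)(jh) = (h^α / (2Γ(α + 3))) · β_j, where β_1 = α(3 + 2α) and, for j ≥ 2, β_j = j^{α+1}(2j − 6 − 3α) + 2j^α(1 + α)(2 + α) − (j − 2)^{α+1}(2j − 2 + α). -/

import Mathlib

/-- The modified hat functions on `[0, τ]` with `n` (even) subintervals of length `h = τ/n`. -/
noncomputable def psiM (τ : ℝ) (n : ℕ) (i : ℕ) : ℝ → ℝ := fun t =>
  if i = 0 then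
    if 0 ≤ t ∧ t ≤ 2 * (τ / n) then
      (1 / (2 * (τ / n) ^ 2)) * (t - τ / n) * (t - 2 * (τ / n)) else 0
  else if i = n then
    if τ - 2 * (τ / n) ≤ t ∧ t ≤ τ then
      (1 / (2 * (τ / n) ^ 2)) * (t - (τ - τ / n)) * (t - (τ - 2 * (τ / n))) else 0
  else if i % 2 = 1 then
    if ((i : ℝ) - 1) * (τ / n) ≤ t ∧ t ≤ ((i : ℝ) + 1) * (τ / n) then
      -(1 / (τ / n) ^ 2) * (t - ((i : ℝ) - 1) * (τ / n)) * (t - ((i : ℝ) + 1) * (τ / n)) else 0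
  else
    if ((i : ℝ) - 2) * (τ / n) ≤ t ∧ t ≤ (i : ℝ) * (τ / n) then
      (1 / (2 * (τ / n) ^ 2)) * (t - ((i : ℝ) - 1) * (τ / n)) * (t - ((i : ℝ) - 2) * (τ / n))
    else if (i : ℝ) * (τ / n) ≤ t ∧ t ≤ ((i : ℝ) + 2) * (τ / n) then
      (1 / (2 * (τ / n) ^ 2)) * (t - ((i : ℝ) + 1) * (τ / n)) * (t - ((i : ℝ) + 2) * (τ / n))
    else 0

/-- The Riemann--Liouville fractional integral of order `α` of `y`. -/
noncomputable def rlInt (α : ℝ) (y : ℝ → ℝ) (t : ℝ) : ℝ :=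
  (1 / Real.Gamma α) * ∫ s in (0 : ℝ)..t, (t - s) ^ (α - 1) * y s

lemma my_congr {f g : ℝ → ℝ} {a b : ℝ} (h : Set.EqOn f g (Set.uIoc a b)) :
    ∫ x in a..b, f x = ∫ x in a..b, g x :=
  intervalIntegral.integral_congr_ae (Filter.Eventually.of_forall fun _ hx => h hx)

open intervalIntegral MeasureTheory in
lemma aux_int (α : ℝ) (hα : 0 < α) (C h t m : ℝ) (hm : 0 ≤ m) (hmt : m ≤ t) :
    IntervalIntegrable (fun s => (t - s) ^ (α - 1) * (C * (s - h) * (s - 2 * h))) volume 0 m ∧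
    ∫ s in (0 : ℝ)..m, (t - s) ^ (α - 1) * (C * (s - h) * (s - 2 * h)) =
      C * ((t ^ (α + 2) - (t - m) ^ (α + 2)) / (α + 2)
        + (3 * h - 2 * t) * ((t ^ (α + 1) - (t - m) ^ (α + 1)) / (α + 1))
        + (t - h) * (t - 2 * h) * ((t ^ α - (t - m) ^ α) / α)) := by
  have i1 : IntervalIntegrable (fun u : ℝ => u ^ (α + 1)) volume (t - m) t :=
    intervalIntegral.intervalIntegrable_rpow' (by linarith)
  have i2 : IntervalIntegrable (fun u : ℝ => u ^ α) volume (t - m) t :=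
    intervalIntegral.intervalIntegrable_rpow' (by linarith)
  have i3 : IntervalIntegrable (fun u : ℝ => u ^ (α - 1)) volume (t - m) t :=
    intervalIntegral.intervalIntegrable_rpow' (by linarith)
  have key : Set.EqOn (fun u : ℝ => C * ((u ^ (α + 1) + (3 * h - 2 * t) * u ^ α)
        + (t - h) * (t - 2 * h) * u ^ (α - 1)))
      (fun u : ℝ => u ^ (α - 1) * (C * ((t - u) - h) * ((t - u) - 2 * h)))
      (Set.uIoc (t - m) t) := by
    intro u hu
    rw [Set.uIoc_of_le (by linarith)] at hu
    have hu0 : 0 < u := by linarith [hu.1]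
    have e1 : u ^ (α + 1) = u ^ (α - 1) * u ^ 2 := by
      rw [← Real.rpow_natCast u 2, ← Real.rpow_add hu0]; congr 1; push_cast; ring
    have e2 : u ^ α = u ^ (α - 1) * u := by
      conv_rhs => rw [← Real.rpow_add_one hu0.ne']
      congr 1; ring
    simp only [e1, e2]
    ring
  have I := ((i1.add (i2.const_mul (3 * h - 2 * t))).add
    (i3.const_mul ((t - h) * (t - 2 * h)))).const_mul C
  have J := I.congr key
  constructor
  · have := (J.comp_sub_left t).symm
    simpa using this
  · have := integral_comp_sub_left (a := 0) (b := m)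
      (fun u : ℝ => u ^ (α - 1) * (C * ((t - u) - h) * ((t - u) - 2 * h))) t
    simp only [sub_sub_cancel, sub_zero] at this
    rw [this, ← my_congr key, intervalIntegral.integral_const_mul,
      intervalIntegral.integral_add (i1.add (i2.const_mul _)) (i3.const_mul _),
      intervalIntegral.integral_add i1 (i2.const_mul _), intervalIntegral.integral_const_mul,
      intervalIntegral.integral_const_mul, integral_rpow (Or.inl (by linarith)),
      integral_rpow (Or.inl (by linarith)), integral_rpow (Or.inl (by linarith))]
    have a1 : α + 1 + 1 = α + 2 := by ring
    have a2 : α - 1 + 1 = α := by ring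
    rw [a1, a2]

lemma aux_pow (α : ℝ) (hα : 0 < α) (x : ℝ) (hx : 0 ≤ x) :
    x ^ (α + 1) = x ^ α * x ∧ x ^ (α + 2) = x ^ α * x ^ 2 := by
  constructor
  · rw [Real.rpow_add_of_nonneg hx hα.le (by norm_num), Real.rpow_one]
  · rw [Real.rpow_add_of_nonneg hx hα.le (by norm_num)]; norm_num

/-- for `1 ≤ j ≤ n`, the Riemann--Liouville fractional integral of order `α`
of `ψ_0^M` at the grid point `jh` equals `(h^α / (2Γ(α+3))) · β_j`, where
`β_1 = α(3 + 2α)` and, for `j ≥ 2`,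
`β_j = j^{α+1}(2j - 6 - 3α) + 2 j^α (1+α)(2+α) - (j-2)^{α+1}(2j - 2 + α)`. -/
theorem rlInt_psiM_zero_row (τ : ℝ) (hτ : 0 < τ) (n : ℕ) (hn : 2 ≤ n) (hne : Even n)
    (α : ℝ) (hα : 0 < α) (j : ℕ) (hj₁ : 1 ≤ j) (hj₂ : j ≤ n) :
    rlInt α (psiM τ n 0) ((j : ℝ) * (τ / n))
      = (τ / n) ^ α / (2 * Real.Gamma (α + 3)) *
        (if j = 1 then α * (3 + 2 * α)
         else (j : ℝ) ^ (α + 1) * (2 * (j : ℝ) - 6 - 3 * α)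
            + 2 * (j : ℝ) ^ α * (1 + α) * (2 + α)
            - ((j : ℝ) - 2) ^ (α + 1) * (2 * (j : ℝ) - 2 + α)) := by
  have hn0 : (0 : ℝ) < n := by exact_mod_cast (by omega : 0 < n)
  have hh : 0 < τ / n := div_pos hτ hn0
  have hG : Real.Gamma (α + 3) = (α + 2) * ((α + 1) * (α * Real.Gamma α)) := by
    rw [show α + 3 = (α + 2) + 1 by ring, Real.Gamma_add_one (by linarith),
      show α + 2 = (α + 1) + 1 by ring, Real.Gamma_add_one (by linarith),
      Real.Gamma_add_one hα.ne']
  have hG0 : Real.Gamma α ≠ 0 := (Real.Gamma_pos_of_pos hα).ne'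
  unfold rlInt
  rw [hG]
  have hp : psiM τ n 0 = fun t => if 0 ≤ t ∧ t ≤ 2 * (τ / n) then
      (1 / (2 * (τ / n) ^ 2)) * (t - τ / n) * (t - 2 * (τ / n)) else 0 := by
    funext t; simp [psiM]
  rw [hp]
  generalize τ / n = h at *
  have hb1 : α + 1 ≠ 0 := by linarith
  have hb2 : α + 2 ≠ 0 := by linarith
  have cong : ∀ t m : ℝ, 0 ≤ m → m ≤ 2 * h →
      Set.EqOn (fun s => (t - s) ^ (α - 1) * (1 / (2 * h ^ 2) * (s - h) * (s - 2 * h)))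
      (fun s => (t - s) ^ (α - 1) * (if 0 ≤ s ∧ s ≤ 2 * h then
      (1 / (2 * h ^ 2)) * (s - h) * (s - 2 * h) else 0)) (Set.uIoc 0 m) := by
    intro t m hm hm2 s hs
    rw [Set.uIoc_of_le hm] at hs
    simp only
    rw [if_pos ⟨hs.1.le, hs.2.trans hm2⟩]
  by_cases hj : j = 1
  · subst hj
    obtain ⟨-, e⟩ := aux_int α hα (1 / (2 * h ^ 2)) h h h hh.le le_rfl
    simp only [Nat.cast_one, one_mul, if_true]
    rw [← my_congr (cong h h hh.le (by linarith)), e,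
      (aux_pow α hα h hh.le).1, (aux_pow α hα h hh.le).2, sub_self,
      Real.zero_rpow hα.ne', Real.zero_rpow hb1, Real.zero_rpow hb2]
    field_simp
    ring
  · rw [if_neg hj]
    have hj2 : (2 : ℝ) ≤ j := by exact_mod_cast (by omega : 2 ≤ j)
    have hjn : (0 : ℝ) ≤ (j : ℝ) - 2 := by linarith
    generalize (j : ℝ) = k at *
    have hle : 2 * h ≤ k * h := by nlinarith
    obtain ⟨i, e⟩ := aux_int α hα (1 / (2 * h ^ 2)) h (k * h) (2 * h) (by linarith) hle
    have c := cong (k * h) (2 * h) (by linarith) le_rfl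
    have z : Set.EqOn (fun _ => (0 : ℝ))
      (fun s => (k * h - s) ^ (α - 1) * (if 0 ≤ s ∧ s ≤ 2 * h then
      (1 / (2 * h ^ 2)) * (s - h) * (s - 2 * h) else 0)) (Set.uIoc (2 * h) (k * h)) := by
      intro s hs
      rw [Set.uIoc_of_le hle] at hs
      simp only
      rw [if_neg (fun hc => absurd hc.2 (not_le.mpr hs.1)), mul_zero]
    have iz := (intervalIntegrable_const (μ := MeasureTheory.volume) (c := (0 : ℝ))
      (a := 2 * h) (b := k * h)).congr z
    rw [← intervalIntegral.integral_add_adjacent_intervals (i.congr c) iz,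
      ← my_congr c, ← my_congr z, e,
      intervalIntegral.integral_zero, add_zero, ← sub_mul]
    have hk : 0 ≤ k := by linarith
    rw [(aux_pow α hα (k * h) (by positivity)).1, (aux_pow α hα (k * h) (by positivity)).2,
      (aux_pow α hα ((k - 2) * h) (by positivity)).1,
      (aux_pow α hα ((k - 2) * h) (by positivity)).2,
      (aux_pow α hα k hk).1, (aux_pow α hα (k - 2) hjn).1,
      Real.mul_rpow hk hh.le, Real.mul_rpow hjn hh.le]
    field_simp
    ring
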